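/- Let n > 2, let ξ : ℝⁿ → ℝⁿ be a smooth CKV of the flat Euclidean metric with conformal factor ψ, let a₀ ∈ ℝ, let b : ℝⁿ → ℝ be smooth, and let f : ℝⁿ × ℝ → ℝ be smooth. Assume the symmetry constraint holds identically in (x, u): ((2−n)/2) Δψ(x) u + Δb(x) − ξ^k(x) ∂_{x^k} f(x,u) − (((2−n)/2) ψ(x) u + a₀ u + b(x)) ∂_u f(x,u) + (a₀ − ((n+2)/2) ψ(x)) f(x,u) = 0. Then for every smooth solution u of the Poisson equation Δu = f(x, u), the characteristic function w(x) = ((2−n)/2) ψ(x) u(x) + a₀ u(x) + b(x) − ξ^k(x) ∂_k u(x) satisfies the linearized equation Δw = ∂_u f(x, u(x)) · w. (This is the evolutionary form of the statement that X = ξ^i ∂_i + (((2−n)/2)ψ u + a₀ u + b) ∂_u is a Lie point symmetry of the Poisson equation, generated by the CKV ξ.) -/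

import Mathlib

/-- Partial derivative `∂f/∂xⁱ` of a function `f : ℝⁿ → ℝ`. -/
noncomputable def pd {n : ℕ} (i : Fin n) (f : (Fin n → ℝ) → ℝ) : (Fin n → ℝ) → ℝ :=
  fun x => fderiv ℝ f x (Pi.single i 1)

/-- The flat Laplacian `Δf = Σ_i ∂²f/∂(xⁱ)²`. -/
noncomputable def lap {n : ℕ} (f : (Fin n → ℝ) → ℝ) : (Fin n → ℝ) → ℝ :=
  fun x => ∑ i, pd i (pd i f) x


abbrev Sm {n : ℕ} (f : (Fin n → ℝ) → ℝ) : Prop := ContDiff ℝ (⊤ : ℕ∞) f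

theorem Sm.da {n : ℕ} {f : (Fin n → ℝ) → ℝ} (hf : Sm f) (x) : DifferentiableAt ℝ f x :=
  (hf.differentiable (by simp)) x

theorem Sm.dpd {n : ℕ} {f : (Fin n → ℝ) → ℝ} (hf : Sm f) (i : Fin n) : Sm (pd i f) := by
  have h : ContDiff ℝ (⊤ : ℕ∞) (fderiv ℝ f) := hf.fderiv_right (by simp)
  exact h.clm_apply contDiff_const

theorem pd_add' {n : ℕ} {f g : (Fin n → ℝ) → ℝ} (hf : Sm f) (hg : Sm g) (i : Fin n) :
    pd i (fun y => f y + g y) = fun y => pd i f y + pd i g y := by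
  funext x
  simp only [pd]
  rw [fderiv_fun_add (hf.da x) (hg.da x)]; rfl

theorem pd_sub' {n : ℕ} {f g : (Fin n → ℝ) → ℝ} (hf : Sm f) (hg : Sm g) (i : Fin n) :
    pd i (fun y => f y - g y) = fun y => pd i f y - pd i g y := by
  funext x
  simp only [pd]
  rw [fderiv_fun_sub (hf.da x) (hg.da x)]; rfl

theorem pd_mul' {n : ℕ} {f g : (Fin n → ℝ) → ℝ} (hf : Sm f) (hg : Sm g) (i : Fin n) :
    pd i (fun y => f y * g y) = fun y => pd i f y * g y + f y * pd i g y := by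
  funext x
  simp only [pd]
  rw [fderiv_fun_mul (hf.da x) (hg.da x)]
  simp; ring

theorem pd_cmul {n : ℕ} {f : (Fin n → ℝ) → ℝ} (hf : Sm f) (c : ℝ) (i : Fin n) :
    pd i (fun y => c * f y) = fun y => c * pd i f y := by
  funext x
  simp only [pd]
  rw [fderiv_const_mul (hf.da x)]; rfl

theorem pd_sum' {n : ℕ} {F : Fin n → (Fin n → ℝ) → ℝ} (hf : ∀ k, Sm (F k)) (i : Fin n) :
    pd i (fun y => ∑ k, F k y) = fun y => ∑ k, pd i (F k) y := by
  funext x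
  simp only [pd]
  rw [fderiv_fun_sum (fun k _ => (hf k).da x)]
  simp

theorem pd_comm' {n : ℕ} {f : (Fin n → ℝ) → ℝ} (hf : Sm f) (i j : Fin n) (x) :
    pd i (pd j f) x = pd j (pd i f) x := by
  have h : ContDiff ℝ (⊤ : ℕ∞) (fderiv ℝ f) := hf.fderiv_right (by simp)
  have hd : DifferentiableAt ℝ (fderiv ℝ f) x := (h.differentiable (by simp)) x
  have key : ∀ a b : Fin n, pd a (pd b f) x
      = fderiv ℝ (fderiv ℝ f) x (Pi.single a 1) (Pi.single b 1) := by
    intro a b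
    change fderiv ℝ (fun y => fderiv ℝ f y (Pi.single b 1)) x (Pi.single a 1) = _
    rw [fderiv_clm_apply hd (differentiableAt_const _)]
    simp
  rw [key, key]
  have hs : IsSymmSndFDerivAt ℝ f x := by
    apply ContDiffAt.isSymmSndFDerivAt (n := ((⊤ : ℕ∞) : WithTop ℕ∞)) hf.contDiffAt
    rw [minSmoothness_of_isRCLikeNormedField]
    exact WithTop.coe_le_coe.2 (le_top : (2 : ℕ∞) ≤ ⊤)
  exact hs _ _

theorem lap_add' {n : ℕ} {f g : (Fin n → ℝ) → ℝ} (hf : Sm f) (hg : Sm g) (x) :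
    lap (fun y => f y + g y) x = lap f x + lap g x := by
  simp only [lap, pd_add' hf hg, pd_add' (hf.dpd _) (hg.dpd _), Finset.sum_add_distrib]

theorem lap_sub' {n : ℕ} {f g : (Fin n → ℝ) → ℝ} (hf : Sm f) (hg : Sm g) (x) :
    lap (fun y => f y - g y) x = lap f x - lap g x := by
  simp only [lap, pd_sub' hf hg, pd_sub' (hf.dpd _) (hg.dpd _), Finset.sum_sub_distrib]

theorem lap_cmul {n : ℕ} {f : (Fin n → ℝ) → ℝ} (hf : Sm f) (c : ℝ) (x) :
    lap (fun y => c * f y) x = c * lap f x := by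
  simp only [lap, pd_cmul hf, pd_cmul (hf.dpd _), Finset.mul_sum]

theorem lap_sum' {n : ℕ} {F : Fin n → (Fin n → ℝ) → ℝ} (hf : ∀ k, Sm (F k)) (x) :
    lap (fun y => ∑ k, F k y) x = ∑ k, lap (F k) x := by
  simp only [lap, pd_sum' hf, pd_sum' (fun k => (hf k).dpd _)]
  exact Finset.sum_comm

theorem lap_mul' {n : ℕ} {f g : (Fin n → ℝ) → ℝ} (hf : Sm f) (hg : Sm g) (x) :
    lap (fun y => f y * g y) x
      = lap f x * g x + 2 * ∑ i, pd i f x * pd i g x + f x * lap g x := by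
  simp only [lap, Finset.mul_sum, Finset.sum_mul, ← Finset.sum_add_distrib]
  refine Finset.sum_congr rfl fun i _ => ?_
  rw [pd_mul' hf hg, pd_add' ((hf.dpd i).mul hg) (hf.mul (hg.dpd i)),
    pd_mul' (hf.dpd i) hg, pd_mul' hf (hg.dpd i)]
  ring

theorem lap_pd {n : ℕ} {u : (Fin n → ℝ) → ℝ} (hu : Sm u) (k : Fin n) (x) :
    lap (pd k u) x = pd k (lap u) x := by
  have : lap u = fun y => ∑ i, pd i (pd i u) y := rfl
  rw [this, pd_sum' (fun i => (hu.dpd i).dpd i)]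
  simp only [lap]
  refine Finset.sum_congr rfl fun i _ => ?_
  have h1 : pd i (pd k u) = pd k (pd i u) := funext fun y => pd_comm' hu i k y
  rw [h1, pd_comm' (hu.dpd i)]

theorem pd_comp' {n : ℕ} (f : (Fin n → ℝ) → ℝ → ℝ)
    (hf : ContDiff ℝ (⊤ : ℕ∞) (fun p : (Fin n → ℝ) × ℝ => f p.1 p.2))
    {u : (Fin n → ℝ) → ℝ} (hu : Sm u) (k : Fin n) (x) :
    pd k (fun y => f y (u y)) x
      = pd k (fun y => f y (u x)) x + deriv (f x) (u x) * pd k u x := by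
  have hF := ((hf.differentiable (by simp)) (x, u x)).hasFDerivAt
  have h1 := hF.comp x ((hasFDerivAt_id x).prodMk (hu.da x).hasFDerivAt)
  have h20 : HasFDerivAt (fun y : Fin n → ℝ => (y, u x))
      ((ContinuousLinearMap.id ℝ (Fin n → ℝ)).prod (0 : (Fin n → ℝ) →L[ℝ] ℝ)) x :=
    (hasFDerivAt_id x).prodMk (hasFDerivAt_const (u x) x)
  have h2 := HasFDerivAt.comp (f := fun y : Fin n → ℝ => (y, u x)) x hF h20
  have h3 := hF.comp_hasDerivAt (u x) ((hasDerivAt_const (u x) x).prodMk (hasDerivAt_id (u x)))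
  have e1 : fderiv ℝ (fun y => f y (u y)) x = _ := h1.fderiv
  have e2 : fderiv ℝ (fun y => f y (u x)) x = _ := h2.fderiv
  have e3 : deriv (f x) (u x) = _ := h3.deriv
  simp only [pd]
  rw [e1, e2, e3]
  generalize fderiv ℝ (fun p : (Fin n → ℝ) × ℝ => f p.1 p.2) (x, u x) = L
  simp only [ContinuousLinearMap.comp_apply, ContinuousLinearMap.prod_apply,
    ContinuousLinearMap.zero_apply, ContinuousLinearMap.id_apply]
  generalize fderiv ℝ u x (Pi.single k 1) = t
  have : ((Pi.single k 1, t) : (Fin n → ℝ) × ℝ) = (Pi.single k 1, 0) + t • (0, 1) := by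
    simp
  rw [this, map_add, map_smul, smul_eq_mul, mul_comm]

/-- Lie point symmetries of the Poisson equation `Δu = f(x,u)` on ℝⁿ, `n > 2`,
in evolutionary form: if `ξ` is a flat CKV with conformal factor `ψ` and the symmetry
constraint holds identically, then for any smooth solution `u` of `Δu = f(x,u)` the
characteristic `w = ((2−n)/2) ψ u + a₀ u + b − ξ^k ∂_k u` solves `Δw = f_u(x,u) w`. -/
theorem stmt_4 {n : ℕ} (hn : 2 < n)
    (ξ : Fin n → (Fin n → ℝ) → ℝ) (ψ : (Fin n → ℝ) → ℝ)
    (hξ : ∀ i, ContDiff ℝ (⊤ : ℕ∞) (ξ i))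
    (hckv : ∀ i j x, pd i (ξ j) x + pd j (ξ i) x =
      2 * ψ x * (if i = j then (1 : ℝ) else 0))
    (a₀ : ℝ) (b : (Fin n → ℝ) → ℝ) (hb : ContDiff ℝ (⊤ : ℕ∞) b)
    (f : (Fin n → ℝ) → ℝ → ℝ)
    (hf : ContDiff ℝ (⊤ : ℕ∞) (fun p : (Fin n → ℝ) × ℝ => f p.1 p.2))
    (hconstraint : ∀ (x : Fin n → ℝ) (u : ℝ),
      ((2 - (n : ℝ)) / 2) * lap ψ x * u + lap b x
        - (∑ k, ξ k x * pd k (fun y => f y u) x)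
        - (((2 - (n : ℝ)) / 2) * ψ x * u + a₀ * u + b x) * deriv (f x) u
        + (a₀ - (((n : ℝ) + 2) / 2) * ψ x) * f x u = 0) :
    ∀ u : (Fin n → ℝ) → ℝ, ContDiff ℝ (⊤ : ℕ∞) u → (∀ x, lap u x = f x (u x)) →
      ∀ x, lap (fun y => ((2 - (n : ℝ)) / 2) * ψ y * u y + a₀ * u y + b y
          - ∑ k, ξ k y * pd k u y) x
        = deriv (f x) (u x) *
          (((2 - (n : ℝ)) / 2) * ψ x * u x + a₀ * u x + b x
            - ∑ k, ξ k x * pd k u x) := by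
  intro u hu hsol x
  have hψ' : ∀ i, ψ = pd i (ξ i) := by
    intro i; funext y
    have := hckv i i y
    simp at this; linarith
  have hψ : Sm ψ := by
    rw [hψ' ⟨0, by omega⟩]; exact Sm.dpd (hξ _) _
  have hξ' : ∀ i, Sm (ξ i) := hξ
  have hu' : Sm u := hu
  have hb' : Sm b := hb
  have hlapξ : ∀ k, lap (ξ k) x = (2 - (n : ℝ)) * pd k ψ x := by
    intro k
    have h1 : ∀ i, pd i (pd i (ξ k)) x
        = (2 * (if i = k then (1 : ℝ) else 0)) * pd i ψ x - pd k ψ x := by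
      intro i
      have e : pd i (ξ k) = fun y => (2 * (if i = k then (1 : ℝ) else 0)) * ψ y - pd k (ξ i) y := by
        funext y
        linarith [hckv i k y]
      rw [e, pd_sub' (contDiff_const.mul hψ) ((hξ' i).dpd k), pd_cmul hψ]
      simp only
      rw [pd_comm' (hξ' i) i k, ← hψ' i]
    simp only [lap, h1, Finset.sum_sub_distrib]
    simp
    ring
  have hcross : 2 * ∑ k, ∑ i, pd i (ξ k) x * pd i (pd k u) x = 2 * ψ x * lap u x := by
    have h2 : ∑ k, ∑ i, pd i (ξ k) x * pd i (pd k u) x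
        = ∑ k, ∑ i, pd k (ξ i) x * pd i (pd k u) x := by
      rw [Finset.sum_comm]
      refine Finset.sum_congr rfl fun k _ => Finset.sum_congr rfl fun i _ => ?_
      rw [pd_comm' hu']
    have h3 : 2 * ∑ k, ∑ i, pd i (ξ k) x * pd i (pd k u) x
        = ∑ k, ∑ i, (pd i (ξ k) x + pd k (ξ i) x) * pd i (pd k u) x := by
      rw [two_mul]
      nth_rewrite 2 [h2]
      simp only [← Finset.sum_add_distrib, add_mul]
    rw [h3]
    simp only [hckv, lap, Finset.mul_sum]
    refine Finset.sum_congr rfl fun k _ => ?_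
    simp
  have hsol' : lap u = fun y => f y (u y) := funext hsol
  have hS : ∀ k, Sm (fun y => ξ k y * pd k u y) := fun k => (hξ' k).mul (hu'.dpd k)
  have hSS : Sm (fun y => ∑ k, ξ k y * pd k u y) := ContDiff.sum fun k _ => hS k
  have hcψ : Sm (fun y => ((2 - (n : ℝ)) / 2) * ψ y) := contDiff_const.mul hψ
  have hau : Sm (fun y => a₀ * u y) := contDiff_const.mul hu'
  rw [lap_sub' (((hcψ.mul hu').add hau).add hb') hSS,
    lap_add' ((hcψ.mul hu').add hau) hb', lap_add' (hcψ.mul hu') hau,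
    lap_mul' hcψ hu', lap_cmul hψ, lap_cmul hu', lap_sum' hS]
  simp only [pd_cmul hψ]
  have hlast : ∑ k, lap (fun y => ξ k y * pd k u y) x
      = (2 - (n : ℝ)) * ∑ k, pd k ψ x * pd k u x + 2 * ψ x * lap u x
        + (∑ k, ξ k x * pd k (fun y => f y (u x)) x)
        + deriv (f x) (u x) * ∑ k, ξ k x * pd k u x := by
    rw [← hcross]
    simp only [Finset.mul_sum, ← Finset.sum_add_distrib]
    refine Finset.sum_congr rfl fun k _ => ?_
    rw [lap_mul' (hξ' k) (hu'.dpd k), hlapξ, lap_pd hu', hsol', pd_comp' f hf hu',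
      Finset.mul_sum]
    ring
  rw [hlast, hsol]
  have hc := hconstraint x (u x)
  have h4 : ∑ i, (2 - (n : ℝ)) / 2 * pd i ψ x * pd i u x
      = (2 - (n : ℝ)) / 2 * ∑ i, pd i ψ x * pd i u x := by
    rw [Finset.mul_sum]
    exact Finset.sum_congr rfl fun i _ => by ring
  rw [h4]
  linear_combination hc
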